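/- arXiv:2402.13971 — 5 statements merged into one kernel-verified Lean document; each statement's English description precedes it below -/
import Mathlib

section
/- Composition law for multi-indice B-series (coefficient-wise in the step size). Let f : ℝ → ℝ be C^∞ and let a, b be finitely supported real-valued maps on populated multi-indices. For n ≥ 1 let B_n(a,f) : ℝ → ℝ be y ↦ ∑_{β populated, |β| = n} (a(β)/S(β)) · F_f[z^β](y) (a finite sum of C^∞ functions), and let B_0(a,f) be the identity map y ↦ y. For a populated multi-indice μ define (b⋆₂a)(μ) := b(μ) + ∑_{k ≥ 0} (1/k!) ∑_α ∑_{(β_1,…,β_k)} a(α) · (∏_{j=1}^k b(β_j)) · S(μ)/(S(α) · ∏_{j=1}^k S(β_j)) · c_μ((∏_{j=1}^k z^{β_j}) · D^k(z^α)), where α runs over populated multi-indices, (β_1,…,β_k) over ordered k-tuples of populated multi-indices, and c_μ(p) denotes the coefficient of the monomial z^μ in the polynomial p; only finitely many summands are nonzero. Then for every n ≥ 1 and every y ∈ ℝ: ∑_{k=0}^{n} (1/k!) ∑_{(n_1,…,n_k)} (d/dy)^k B_{n−(n_1+⋯+n_k)}(a,f)(y) · ∏_{i=1}^{k} B_{n_i}(b,f)(y)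 = ∑_{μ populated, |μ| = n} ((b⋆₂a)(μ)/S(μ)) · F_f[z^μ](y), where the inner sum on the left runs over all k-tuples (n_1, …, n_k) of positive integers with n_1 + ⋯ + n_k ≤ n. (The left side is the h^n-coefficient of the Taylor expansion of the composition B(a,h,f,·) ∘ B(b,h,f,y) and the right side that of B(b⋆₂a,h,f,y), for characters with a(𝟎) = b(𝟎) = 1.) -/
open MvPolynomial
open scoped Classical

/-- Multi-indices: finitely supported functions `ℕ → ℕ`. -/
abbrev MI := ℕ →₀ ℕ

/-- The monomial `z^β = ∏_k X_k^{β k}` in `ℝ[X_0, X_1, …]`. -/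
noncomputable def zm (β : MI) : MvPolynomial ℕ ℝ := monomial β 1

/-- `β` is populated if `∑_k (1 - k) β(k) = 1`. -/
def Populated (β : MI) : Prop := (β.sum fun k n => (1 - (k : ℤ)) * n) = 1

/-- The length `|β| = ∑_k β(k)`. -/
def len (β : MI) : ℕ := β.sum fun _ n => n

/-- The symmetry factor `S(β) = ∏_k (k!)^{β k}`. -/
noncomputable def S (β : MI) : ℝ := β.prod fun k n => (k.factorial : ℝ) ^ n

/-- The derivation `D` with `D X_k = X_{k+1}`. -/
noncomputable def Dop (p : MvPolynomial ℕ ℝ) : MvPolynomial ℕ ℝ :=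
  ∑ᶠ k : ℕ, X (k + 1) * pderiv k p

/-- The elementary differential `F_f[p](y)`: evaluate `p` at `X_k ↦ f^{(k)}(y)`. -/
noncomputable def Ff (f : ℝ → ℝ) (p : MvPolynomial ℕ ℝ) (y : ℝ) : ℝ :=
  eval (fun k => iteratedDeriv k f y) p

/-- The `h^n`-coefficient `B_n(a,f)` of a multi-indice B-series; `B_0` is the identity. -/
noncomputable def Bser (a : MI → ℝ) (f : ℝ → ℝ) : ℕ → ℝ → ℝ
  | 0 => fun y => y
  | n + 1 => fun y =>
      ∑ᶠ β : MI, if Populated β ∧ len β = n + 1 then a β / S β * Ff f (zm β) y else 0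

/-- The product `(b ⋆₂ a)(μ)`. -/
noncomputable def star2 (b a : MI → ℝ) (μ : MI) : ℝ :=
  b μ + ∑ᶠ k : ℕ, (k.factorial : ℝ)⁻¹ *
    ∑ᶠ α : MI, ∑ᶠ βs : Fin k → MI,
      if Populated α ∧ ∀ j, Populated (βs j) then
        a α * (∏ j, b (βs j)) * (S μ / (S α * ∏ j, S (βs j))) *
          coeff μ ((∏ j, zm (βs j)) * Dop^[k] (zm α))
      else 0

/-- The bidegree of the variable `X_k`: length one and weight `1 - k`. -/
def varDeg (k : ℕ) : ℕ × ℤ := (1, 1 - (k : ℤ))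

theorem weight_varDeg (β : MI) :
    Finsupp.weight varDeg β = (len β, β.sum fun k n => (1 - (k : ℤ)) * n) := by
  simp only [Finsupp.weight_apply, len, Finsupp.sum, varDeg]
  ext
  · simp [Prod.fst_sum]
  · simp [Prod.snd_sum, mul_comm]

theorem weight_varDeg_eq_iff (β : MI) (n : ℕ) :
    Finsupp.weight varDeg β = (n, 1) ↔ Populated β ∧ len β = n := by
  rw [weight_varDeg, Prod.mk.injEq, and_comm]
  rfl

theorem Populated.one_le_len {β : MI} (h : Populated β) : 1 ≤ len β := by
  by_contra! h0
  have : β = 0 := by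
    ext k
    by_contra hk
    have := Finset.single_le_sum (f := fun k => β k) (fun _ _ => Nat.zero_le _)
      (Finsupp.mem_support_iff.2 hk)
    simp only [len, Finsupp.sum] at h0
    simp only [Finsupp.coe_zero, Pi.zero_apply] at hk
    omega
  subst this
  simp [Populated] at h

theorem finite_populated_len (n : ℕ) : {β : MI | Populated β ∧ len β = n}.Finite := by
  refine (Set.finite_Iic (∑ k ∈ Finset.range (n + 1), Finsupp.single k n)).subset ?_
  rintro β ⟨hp, hl⟩ k
  by_cases hk : β k = 0
  · simp [hk]
  have hmem := Finsupp.mem_support_iff.2 hk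
  have h1 : β k ≤ n := by
    rw [← hl]
    exact Finset.single_le_sum (f := fun k => β k) (fun _ _ => Nat.zero_le _) hmem
  have h2 : k * β k ≤ ∑ i ∈ β.support, i * β i :=
    Finset.single_le_sum (f := fun k => k * β k) (fun _ _ => Nat.zero_le _) hmem
  have h3 : (∑ i ∈ β.support, ((i * β i : ℕ) : ℤ)) = n - 1 := by
    have : (∑ i ∈ β.support, (1 - (i : ℤ)) * β i) = 1 := hp
    have h4 : (∑ i ∈ β.support, β i) = n := hl
    rw [← h4, ← this]
    push_cast
    rw [← Finset.sum_sub_distrib]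
    exact Finset.sum_congr rfl fun i _ => by ring
  have h5 : k < n + 1 := by
    have : k ≤ k * β k := Nat.le_mul_of_pos_right _ (Nat.pos_of_ne_zero hk)
    zify at h2 this ⊢
    push_cast at h3
    linarith
  simp [Finsupp.finsetSum_apply, Finsupp.single_apply, h5, h1]

theorem S_ne_zero (β : MI) : S β ≠ 0 :=
  Finset.prod_ne_zero_iff.2 fun _ _ => pow_ne_zero _ (by positivity)

theorem Dop_eq_sum (p : MvPolynomial ℕ ℝ) :
    Dop p = ∑ k ∈ p.vars, X (k + 1) * pderiv k p := by
  refine finsum_eq_sum_of_support_subset _ fun k hk => ?_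
  by_contra h
  exact hk (by simp [pderiv_eq_zero_of_notMem_vars (show k ∉ p.vars from h)])

theorem finite_support_Dop (p : MvPolynomial ℕ ℝ) :
    (Function.support fun k : ℕ => X (k + 1) * pderiv k p).Finite := by
  refine p.vars.finite_toSet.subset fun k hk => ?_
  by_contra h
  exact hk (by simp [pderiv_eq_zero_of_notMem_vars (show k ∉ p.vars from h)])

theorem Dop_add (p q : MvPolynomial ℕ ℝ) : Dop (p + q) = Dop p + Dop q := by
  simp only [Dop, map_add, mul_add]
  exact finsum_add_distrib (finite_support_Dop p) (finite_support_Dop q)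

theorem Dop_smul (c : ℝ) (p : MvPolynomial ℕ ℝ) : Dop (c • p) = c • Dop p := by
  simp only [Dop, Derivation.map_smul, mul_smul_comm]
  exact (smul_finsum' c (finite_support_Dop p)).symm

/-- `Dop` as a linear map. -/
noncomputable def DopLin : MvPolynomial ℕ ℝ →ₗ[ℝ] MvPolynomial ℕ ℝ where
  toFun := Dop
  map_add' := Dop_add
  map_smul' := Dop_smul

theorem iterate_Dop (k : ℕ) (p : MvPolynomial ℕ ℝ) : Dop^[k] p = (DopLin ^ k) p := by
  rw [Module.End.pow_apply]
  rfl

theorem Dop_C (c : ℝ) : Dop (C c) = 0 := by simp [Dop]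

theorem Dop_mul_X (p : MvPolynomial ℕ ℝ) (i : ℕ) :
    Dop (p * X i) = Dop p * X i + p * X (i + 1) := by
  have h1 (k : ℕ) : (X (k + 1) * pderiv k (p * X i) : MvPolynomial ℕ ℝ) =
      X (k + 1) * pderiv k p * X i + if k = i then p * X (i + 1) else 0 := by
    rw [Derivation.leibniz, pderiv_X]
    split_ifs with h
    · subst h
      simp
      ring
    · simp [Pi.single_eq_of_ne (Ne.symm h)]
      ring
  unfold Dop
  simp_rw [h1]
  rw [finsum_add_distrib, ← finsum_mul' _ _ (finite_support_Dop p),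
    finsum_eq_single (fun k => if k = i then _ else _) i]
  · simp
  · intro k hk
    simp [hk]
  · exact (finite_support_Dop p).subset fun k hk h => hk (by simp_all)
  · refine (Set.finite_singleton i).subset fun k hk => ?_
    by_contra h
    exact hk (if_neg h)

theorem Ff_add (f : ℝ → ℝ) (p q : MvPolynomial ℕ ℝ) (y : ℝ) :
    Ff f (p + q) y = Ff f p y + Ff f q y := map_add _ _ _

theorem Ff_mul (f : ℝ → ℝ) (p q : MvPolynomial ℕ ℝ) (y : ℝ) :
    Ff f (p * q) y = Ff f p y * Ff f q y := map_mul _ _ _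

theorem Ff_smul (f : ℝ → ℝ) (c : ℝ) (p : MvPolynomial ℕ ℝ) (y : ℝ) :
    Ff f (c • p) y = c * Ff f p y := smul_eval _ _ _

theorem Ff_prod {ι : Type*} (f : ℝ → ℝ) (s : Finset ι) (p : ι → MvPolynomial ℕ ℝ) (y : ℝ) :
    Ff f (∏ i ∈ s, p i) y = ∏ i ∈ s, Ff f (p i) y := map_prod _ _ _

theorem Ff_sum {ι : Type*} (f : ℝ → ℝ) (s : Finset ι) (p : ι → MvPolynomial ℕ ℝ) (y : ℝ) :
    Ff f (∑ i ∈ s, p i) y = ∑ i ∈ s, Ff f (p i) y := map_sum _ _ _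

theorem Ff_eq_sum_coeff (f : ℝ → ℝ) (p : MvPolynomial ℕ ℝ) (y : ℝ) :
    Ff f p y = ∑ μ ∈ p.support, coeff μ p * Ff f (zm μ) y := by
  conv_lhs => rw [p.as_sum, Ff_sum]
  refine Finset.sum_congr rfl fun μ _ => ?_
  simp [Ff, zm, eval_monomial]

theorem hasDerivAt_Ff {f : ℝ → ℝ} (hf : ContDiff ℝ (⊤ : ℕ∞) f) (p : MvPolynomial ℕ ℝ) (y : ℝ) :
    HasDerivAt (Ff f p) (Ff f (Dop p) y) y := by
  induction p using MvPolynomial.induction_on with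
  | C c =>
    have h : Ff f (C c) = fun _ => c := funext fun z => eval_C _
    have h0 : Ff f 0 y = 0 := map_zero _
    rw [Dop_C, h0, h]
    exact hasDerivAt_const y c
  | add p q hp hq =>
    have h : Ff f (p + q) = Ff f p + Ff f q := funext (Ff_add f p q)
    rw [Dop_add, Ff_add, h]
    exact hp.add hq
  | mul_X p i hp =>
    have hX (j : ℕ) : Ff f (X j) = iteratedDeriv j f := funext fun z => eval_X _
    have h : Ff f (p * X i) = Ff f p * iteratedDeriv i f := by
      rw [← hX]
      exact funext (Ff_mul f p _)
    rw [Dop_mul_X, Ff_add, Ff_mul, Ff_mul, hX, hX, h, iteratedDeriv_succ]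
    exact hp.mul ((hf.differentiable_iteratedDeriv i
      (by exact_mod_cast WithTop.coe_lt_top _)).differentiableAt.hasDerivAt)

theorem iteratedDeriv_Ff {f : ℝ → ℝ} (hf : ContDiff ℝ (⊤ : ℕ∞) f) (p : MvPolynomial ℕ ℝ) (k : ℕ) :
    iteratedDeriv k (Ff f p) = Ff f (Dop^[k] p) := by
  induction k with
  | zero => simp
  | succ k ih =>
    rw [iteratedDeriv_succ, ih, Function.iterate_succ_apply']
    exact funext fun y => (hasDerivAt_Ff hf _ y).deriv

theorem isWeightedHomogeneous_Dop {p : MvPolynomial ℕ ℝ} {m : ℕ} {w : ℤ}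
    (hp : IsWeightedHomogeneous varDeg p (m, w)) :
    IsWeightedHomogeneous varDeg (Dop p) (m, w - 1) := by
  rw [Dop_eq_sum]
  refine IsWeightedHomogeneous.sum _ _ _ fun k _ => ?_
  obtain _ | m := m
  · have : pderiv k p = 0 := by
      refine pderiv_eq_zero_of_notMem_vars fun hk => ?_
      obtain ⟨d, hd, hkd⟩ := mem_vars_iff_mem_support k |>.1 hk
      have h := congrArg Prod.fst (hp (mem_support_iff.1 hd))
      simp only [weight_varDeg, len, Finsupp.sum, Finset.sum_eq_zero_iff] at h
      exact Finsupp.mem_support_iff.1 hkd (h k hkd)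
    rw [this, mul_zero]
    exact isWeightedHomogeneous_zero ..
  · have h := (isWeightedHomogeneous_X ℝ varDeg (k + 1)).mul
      (hp.pderiv (i := k) (n' := (m, w - (1 - k))) (by simp [varDeg]))
    convert h using 1
    simp only [varDeg, Prod.mk_add_mk, Prod.mk.injEq]
    refine ⟨add_comm _ _, ?_⟩
    push_cast
    ring

theorem isWeightedHomogeneous_iterate_Dop {p : MvPolynomial ℕ ℝ} {m : ℕ} {w : ℤ} (k : ℕ)
    (hp : IsWeightedHomogeneous varDeg p (m, w)) :
    IsWeightedHomogeneous varDeg (Dop^[k] p) (m, w - k) := by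
  induction k with
  | zero => simpa using hp
  | succ k ih =>
    rw [Function.iterate_succ_apply']
    convert isWeightedHomogeneous_Dop ih using 2
    push_cast
    ring

theorem isWeightedHomogeneous_zm {β : MI} (h : Populated β) :
    IsWeightedHomogeneous varDeg (zm β) (len β, 1) :=
  isWeightedHomogeneous_monomial _ _ _ ((weight_varDeg_eq_iff _ _).2 ⟨h, rfl⟩)

/-- The polynomial obtained by inserting the monomials `z^{β_j}` into `z^α`. -/
noncomputable def insertion {k : ℕ} (α : MI) (βs : Fin k → MI) : MvPolynomial ℕ ℝ :=
  (∏ j, zm (βs j)) * Dop^[k] (zm α)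

theorem isWeightedHomogeneous_insertion {k : ℕ} {α : MI} {βs : Fin k → MI}
    (hα : Populated α) (hβ : ∀ j, Populated (βs j)) :
    IsWeightedHomogeneous varDeg (insertion α βs) (len α + ∑ j, len (βs j), 1) := by
  have h1 := IsWeightedHomogeneous.prod Finset.univ (fun j => zm (βs j)) _
    (fun j _ => isWeightedHomogeneous_zm (hβ j))
  have h2 := h1.mul (isWeightedHomogeneous_iterate_Dop k (isWeightedHomogeneous_zm hα))
  refine (congrArg _ ?_).mp h2
  refine Prod.ext ?_ ?_
  · simp [Prod.fst_sum, add_comm]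
  · simp [Prod.snd_sum]

theorem sum_coeff_mul_Ff_of_isWeightedHomogeneous (f : ℝ → ℝ) {p : MvPolynomial ℕ ℝ} {m : ℕ}
    (hp : IsWeightedHomogeneous varDeg p (m, 1)) (n : ℕ) (y : ℝ) :
    ∑ μ ∈ (finite_populated_len n).toFinset, coeff μ p * Ff f (zm μ) y =
      if m = n then Ff f p y else 0 := by
  split_ifs with h
  · subst h
    rw [Ff_eq_sum_coeff]
    refine (Finset.sum_subset (fun μ hμ => ?_) fun μ _ hμ => ?_).symm
    · simpa using (weight_varDeg_eq_iff _ _).1 (hp (mem_support_iff.1 hμ))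
    · rw [notMem_support_iff.1 hμ, zero_mul]
  · refine Finset.sum_eq_zero fun μ hμ => ?_
    rw [hp.coeff_eq_zero, zero_mul]
    rw [(weight_varDeg_eq_iff μ n).2 (by simpa using hμ)]
    simpa using Ne.symm h

/-- The length-`m` part of a finitely supported B-series, as a polynomial. -/
noncomputable def lenPart (a : MI → ℝ) (A : Finset MI) (m : ℕ) : MvPolynomial ℕ ℝ :=
  ∑ α ∈ A, (if len α = m then a α / S α else 0) • zm α

theorem Ff_lenPart (a : MI → ℝ) (A : Finset MI) (m : ℕ) (f : ℝ → ℝ) (y : ℝ) :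
    Ff f (lenPart a A m) y = ∑ α ∈ A, (if len α = m then a α / S α else 0) * Ff f (zm α) y := by
  simp only [lenPart, Ff_sum, Ff_smul]

theorem Ff_iterate_Dop_lenPart (a : MI → ℝ) (A : Finset MI) (k m : ℕ) (f : ℝ → ℝ) (y : ℝ) :
    Ff f (Dop^[k] (lenPart a A m)) y =
      ∑ α ∈ A, (if len α = m then a α / S α else 0) * Ff f (Dop^[k] (zm α)) y := by
  simp only [lenPart, iterate_Dop, map_sum, map_smul, Ff_sum, Ff_smul]

theorem Bser_of_pos {a : MI → ℝ} (haf : (Function.support a).Finite)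
    (hap : ∀ β, ¬ Populated β → a β = 0) (f : ℝ → ℝ) {m : ℕ} (hm : 1 ≤ m) :
    Bser a f m = Ff f (lenPart a haf.toFinset m) := by
  obtain ⟨m, rfl⟩ := Nat.exists_eq_add_of_le' hm
  funext y
  rw [Ff_lenPart]
  simp only [Bser]
  rw [finsum_eq_sum_of_support_subset (s := haf.toFinset)]
  · refine Finset.sum_congr rfl fun β hβ => ?_
    have : Populated β := by
      by_contra h
      exact (by simpa using hβ : a β ≠ 0) (hap β h)
    simp [this]
  · intro β hβ
    simp only [Function.mem_support] at hβ
    simp only [Set.Finite.coe_toFinset, Function.mem_support]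
    intro h
    simp [h] at hβ

theorem lenPart_zero {a : MI → ℝ} {A : Finset MI} (hA : ∀ α ∈ A, Populated α) :
    lenPart a A 0 = 0 := by
  refine Finset.sum_eq_zero fun α hα => ?_
  have := (hA α hα).one_le_len
  rw [if_neg (by omega), zero_smul]

theorem iteratedDeriv_Bser {a : MI → ℝ} (haf : (Function.support a).Finite)
    (hap : ∀ β, ¬ Populated β → a β = 0) {f : ℝ → ℝ} (hf : ContDiff ℝ (⊤ : ℕ∞) f)
    (k m : ℕ) (y : ℝ) :
    iteratedDeriv k (Bser a f m) y = Ff f (Dop^[k] (lenPart a haf.toFinset m)) y +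
      if m = 0 then (if k = 0 then y else if k = 1 then 1 else 0) else 0 := by
  obtain rfl | hm := Nat.eq_zero_or_pos m
  · rw [lenPart_zero fun α hα => by
      by_contra h
      exact (by simpa using hα : a α ≠ 0) (hap α h)]
    have h0 : Ff f (0 : MvPolynomial ℕ ℝ) y = 0 := map_zero _
    rw [iterate_Dop, map_zero, h0, zero_add, if_pos rfl]
    exact iteratedDeriv_fun_id
  · rw [Bser_of_pos haf hap f hm, iteratedDeriv_Ff hf, if_neg (by omega), add_zero]

theorem finsum_tuple_eq_sum {k n : ℕ} (F : (Fin k → ℕ) → ℝ) :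
    (∑ᶠ t : Fin k → ℕ, if (∀ i, 1 ≤ t i) ∧ (∑ i, t i) ≤ n then F t else 0) =
      ∑ t ∈ Fintype.piFinset fun _ : Fin k => Finset.range (n + 1),
        if (∀ i, 1 ≤ t i) ∧ (∑ i, t i) ≤ n then F t else 0 := by
  refine finsum_eq_sum_of_support_subset _ fun t ht => ?_
  simp only [Function.mem_support, ne_eq, ite_eq_right_iff, Classical.not_imp] at ht
  simp only [Finset.mem_coe, Fintype.mem_piFinset, Finset.mem_range]
  intro i
  have := Finset.single_le_sum (f := t) (fun _ _ => Nat.zero_le _) (Finset.mem_univ i)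
  omega

theorem sum_tuple_Ff_lenPart (a b : MI → ℝ) {A B : Finset MI} (hB : ∀ β ∈ B, Populated β)
    (f : ℝ → ℝ) (k n : ℕ) (y : ℝ) :
    (∑ t ∈ Fintype.piFinset fun _ : Fin k => Finset.range (n + 1),
        if (∀ i, 1 ≤ t i) ∧ (∑ i, t i) ≤ n then
          Ff f (Dop^[k] (lenPart a A (n - ∑ i, t i))) y * ∏ i, Ff f (lenPart b B (t i)) y
        else 0) =
      ∑ α ∈ A, ∑ βs ∈ Fintype.piFinset fun _ : Fin k => B,
        a α / S α * (∏ j, b (βs j) / S (βs j)) *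
          if len α + ∑ j, len (βs j) = n then Ff f (insertion α βs) y else 0 := by
  have key (t : Fin k → ℕ) :
      (if (∀ i, 1 ≤ t i) ∧ (∑ i, t i) ≤ n then
          Ff f (Dop^[k] (lenPart a A (n - ∑ i, t i))) y * ∏ i, Ff f (lenPart b B (t i)) y
        else 0) =
      ∑ α ∈ A, ∑ βs ∈ Fintype.piFinset fun _ : Fin k => B,
        if ((∀ i, 1 ≤ t i) ∧ (∑ i, t i) ≤ n) ∧ len α = n - ∑ i, t i ∧ ∀ i, len (βs i) = t i then
          a α / S α * (∏ j, b (βs j) / S (βs j)) * Ff f (insertion α βs) y else 0 := by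
    split_ifs with h
    · simp only [Ff_iterate_Dop_lenPart, Ff_lenPart]
      rw [Finset.prod_univ_sum, Finset.sum_mul_sum]
      refine Finset.sum_congr rfl fun α _ => Finset.sum_congr rfl fun βs _ => ?_
      rw [Finset.prod_mul_distrib, Finset.prod_ite_zero, insertion, Ff_mul, Ff_prod]
      simp only [Finset.mem_univ, true_imp_iff, h]
      by_cases h1 : len α = n - ∑ i, t i
      · by_cases h2 : ∀ i, len (βs i) = t i
        · simp only [h1, h2, implies_true, if_true, and_self]
          ring
        · simp only [h2, and_false, if_false, zero_mul, mul_zero]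
      · simp only [h1, false_and, and_false, if_false, zero_mul]
    · simp [h]
  rw [Finset.sum_congr rfl fun t _ => key t, Finset.sum_comm]
  refine Finset.sum_congr rfl fun α _ => ?_
  rw [Finset.sum_comm]
  refine Finset.sum_congr rfl fun βs hβs => ?_
  have hpos (i : Fin k) : 1 ≤ len (βs i) := (hB _ (Fintype.mem_piFinset.1 hβs i)).one_le_len
  rw [Finset.sum_eq_single fun i => len (βs i)]
  · beta_reduce
    by_cases h : len α + ∑ j, len (βs j) = n
    · rw [if_pos h, if_pos ⟨⟨hpos, by omega⟩, by omega, fun _ => rfl⟩]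
    · rw [if_neg h, mul_zero, if_neg fun h' => h (by have := h'.1.2; have := h'.2.1; omega)]
  · intro t _ ht
    exact if_neg fun h => ht (funext fun i => (h.2.2 i).symm)
  · intro ht
    refine if_neg fun h => ht ?_
    simp only [Fintype.mem_piFinset, Finset.mem_range]
    intro i
    have := Finset.single_le_sum (f := fun i => len (βs i)) (fun _ _ => Nat.zero_le _)
      (Finset.mem_univ i)
    have := h.1.2
    beta_reduce at this ⊢
    omega

theorem finsum_insertion_eq_sum {a b : MI → ℝ} (haf : (Function.support a).Finite)
    (hbf : (Function.support b).Finite) (hap : ∀ β, ¬ Populated β → a β = 0)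
    (hbp : ∀ β, ¬ Populated β → b β = 0) (k : ℕ) (μ : MI) :
    (∑ᶠ α : MI, ∑ᶠ βs : Fin k → MI,
      if Populated α ∧ ∀ j, Populated (βs j) then
        a α * (∏ j, b (βs j)) * (S μ / (S α * ∏ j, S (βs j))) *
          coeff μ ((∏ j, zm (βs j)) * Dop^[k] (zm α))
      else 0) =
    S μ * ∑ α ∈ haf.toFinset, ∑ βs ∈ Fintype.piFinset fun _ : Fin k => hbf.toFinset,
        a α / S α * (∏ j, b (βs j) / S (βs j)) * coeff μ (insertion α βs) := by
  have hterm (α : MI) (βs : Fin k → MI) :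
      (if Populated α ∧ ∀ j, Populated (βs j) then
        a α * (∏ j, b (βs j)) * (S μ / (S α * ∏ j, S (βs j))) *
          coeff μ ((∏ j, zm (βs j)) * Dop^[k] (zm α)) else 0) =
      S μ * (a α / S α * (∏ j, b (βs j) / S (βs j)) * coeff μ (insertion α βs)) := by
    split_ifs with h
    · rw [insertion, Finset.prod_div_distrib]
      ring
    · rw [not_and_or, not_forall] at h
      obtain h | ⟨j, h⟩ := h
      · simp [hap α h]
      · rw [Finset.prod_eq_zero (Finset.mem_univ j) (by simp [hbp _ h])]
        simp
  simp_rw [hterm]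
  rw [finsum_eq_sum_of_support_subset (s := haf.toFinset), Finset.mul_sum]
  · refine Finset.sum_congr rfl fun α _ => ?_
    rw [finsum_eq_sum_of_support_subset (s := Fintype.piFinset fun _ : Fin k => hbf.toFinset),
      Finset.mul_sum]
    intro βs hβs
    simp only [Finset.mem_coe, Fintype.mem_piFinset, Set.Finite.mem_toFinset, Function.mem_support]
    intro j hj
    refine hβs ?_
    beta_reduce
    rw [Finset.prod_eq_zero (Finset.mem_univ j) (by simp [hj])]
    simp
  · intro α hα
    simp only [Set.Finite.coe_toFinset, Function.mem_support]
    intro h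
    exact hα (by simp [h])

theorem star2_div_S {a b : MI → ℝ} (haf : (Function.support a).Finite)
    (hbf : (Function.support b).Finite) (hap : ∀ β, ¬ Populated β → a β = 0)
    (hbp : ∀ β, ¬ Populated β → b β = 0) (μ : MI) :
    star2 b a μ / S μ = b μ / S μ + ∑ k ∈ Finset.range (len μ + 1), (k.factorial : ℝ)⁻¹ *
      ∑ α ∈ haf.toFinset, ∑ βs ∈ Fintype.piFinset fun _ : Fin k => hbf.toFinset,
        a α / S α * (∏ j, b (βs j) / S (βs j)) * coeff μ (insertion α βs) := by
  have hS := S_ne_zero μ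
  simp only [star2, finsum_insertion_eq_sum haf hbf hap hbp]
  rw [finsum_eq_sum_of_support_subset (s := Finset.range (len μ + 1)), add_div, Finset.sum_div]
  · congr 1
    refine Finset.sum_congr rfl fun k _ => ?_
    field_simp
  · intro k hk
    by_contra hlt
    simp only [Finset.coe_range, Set.mem_Iio, not_lt] at hlt
    refine hk ?_
    beta_reduce
    rw [Finset.sum_eq_zero, mul_zero, mul_zero]
    refine fun α hα => Finset.sum_eq_zero fun βs hβs => ?_
    have hα' : Populated α := by
      by_contra h
      exact (by simpa using hα : a α ≠ 0) (hap α h)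
    have hβ' (j : Fin k) : Populated (βs j) := by
      by_contra h
      exact (by simpa using Fintype.mem_piFinset.1 hβs j : b (βs j) ≠ 0) (hbp _ h)
    rw [(isWeightedHomogeneous_insertion hα' hβ').coeff_eq_zero, mul_zero]
    rw [weight_varDeg]
    intro h
    have h1 := congrArg Prod.fst h
    have h2 : ∑ _j : Fin k, 1 ≤ ∑ j, len (βs j) :=
      Finset.sum_le_sum fun j _ => (hβ' j).one_le_len
    simp only [Finset.sum_const, Finset.card_univ, Fintype.card_fin, smul_eq_mul, mul_one] at h2
    simp only at h1
    omega

/-- The contribution of the identity component of the outer series: only the first derivative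
survives. -/
theorem sum_tuple_identity (c : ℕ → ℝ) {n : ℕ} (hn : 1 ≤ n) (y : ℝ) :
    (∑ k ∈ Finset.range (n + 1), (k.factorial : ℝ)⁻¹ *
      ∑ t ∈ Fintype.piFinset fun _ : Fin k => Finset.range (n + 1),
        if (∀ i, 1 ≤ t i) ∧ (∑ i, t i) ≤ n then
          (if n - ∑ i, t i = 0 then (if k = 0 then y else if k = 1 then 1 else 0) else 0) *
            ∏ i, c (t i)
        else 0) = c n := by
  rw [Finset.sum_eq_single 1]
  · rw [Finset.sum_eq_single fun _ => n]
    · simp [hn]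
    · intro t _ ht
      have h0 : t 0 ≠ n := fun h => ht (funext fun i => by rw [Subsingleton.elim i 0, h])
      simp only [Finset.univ_unique, Fin.default_eq_zero, Finset.sum_singleton]
      split_ifs <;> first | omega | simp
    · intro h
      simp at h
  · intro k _ hk
    rw [Finset.sum_eq_zero, mul_zero]
    intro t _
    obtain rfl | hk0 := Nat.eq_zero_or_pos k
    · simp
      omega
    · simp [hk, hk0.ne']
  · intro h
    simp at h
    omega

/-- Composition law for multi-indice B-series, coefficient-wise in the step size. -/
theorem composition_law_multiindice_Bseries
    (f : ℝ → ℝ) (hf : ContDiff ℝ (⊤ : ℕ∞) f)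
    (a b : MI → ℝ)
    (haf : (Function.support a).Finite) (hbf : (Function.support b).Finite)
    (hap : ∀ β, ¬ Populated β → a β = 0) (hbp : ∀ β, ¬ Populated β → b β = 0)
    (n : ℕ) (hn : 1 ≤ n) (y : ℝ) :
    (∑ k ∈ Finset.range (n + 1), (k.factorial : ℝ)⁻¹ *
      ∑ᶠ t : Fin k → ℕ,
        if (∀ i, 1 ≤ t i) ∧ (∑ i, t i) ≤ n then
          iteratedDeriv k (Bser a f (n - ∑ i, t i)) y * ∏ i, Bser b f (t i) y
        else 0)
    = ∑ᶠ μ : MI, if Populated μ ∧ len μ = n then star2 b a μ / S μ * Ff f (zm μ) y else 0 := by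
  have hA : ∀ α ∈ haf.toFinset, Populated α := fun α hα => by
    by_contra h
    exact (by simpa using hα : a α ≠ 0) (hap α h)
  have hB : ∀ β ∈ hbf.toFinset, Populated β := fun β hβ => by
    by_contra h
    exact (by simpa using hβ : b β ≠ 0) (hbp β h)
  have hBser (k : ℕ) (t : Fin k → ℕ) :
      (if (∀ i, 1 ≤ t i) ∧ (∑ i, t i) ≤ n then
          iteratedDeriv k (Bser a f (n - ∑ i, t i)) y * ∏ i, Bser b f (t i) y
        else 0) =
      (if (∀ i, 1 ≤ t i) ∧ (∑ i, t i) ≤ n then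
          Ff f (Dop^[k] (lenPart a haf.toFinset (n - ∑ i, t i))) y *
            ∏ i, Ff f (lenPart b hbf.toFinset (t i)) y
        else 0) +
      (if (∀ i, 1 ≤ t i) ∧ (∑ i, t i) ≤ n then
          (if n - ∑ i, t i = 0 then (if k = 0 then y else if k = 1 then 1 else 0) else 0) *
            ∏ i, Ff f (lenPart b hbf.toFinset (t i)) y
        else 0) := by
    split_ifs with h
    all_goals try rw [Finset.prod_congr rfl fun i _ => congrFun (Bser_of_pos hbf hbp f (h.1 i)) y,
      iteratedDeriv_Bser haf hap hf, add_mul]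
    all_goals simp_all
  have hlhs : (∑ k ∈ Finset.range (n + 1), (k.factorial : ℝ)⁻¹ *
      ∑ᶠ t : Fin k → ℕ,
        if (∀ i, 1 ≤ t i) ∧ (∑ i, t i) ≤ n then
          iteratedDeriv k (Bser a f (n - ∑ i, t i)) y * ∏ i, Bser b f (t i) y
        else 0) =
      (∑ k ∈ Finset.range (n + 1), (k.factorial : ℝ)⁻¹ *
        ∑ α ∈ haf.toFinset, ∑ βs ∈ Fintype.piFinset fun _ : Fin k => hbf.toFinset,
          a α / S α * (∏ j, b (βs j) / S (βs j)) *
            if len α + ∑ j, len (βs j) = n then Ff f (insertion α βs) y else 0) +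
      Ff f (lenPart b hbf.toFinset n) y := by
    rw [← sum_tuple_identity (fun m => Ff f (lenPart b hbf.toFinset m) y) hn y,
      ← Finset.sum_add_distrib]
    refine Finset.sum_congr rfl fun k _ => ?_
    rw [finsum_tuple_eq_sum, Finset.sum_congr rfl fun t _ => hBser k t, Finset.sum_add_distrib,
      mul_add, sum_tuple_Ff_lenPart a b hB]
  rw [hlhs, finsum_eq_sum_of_support_subset (s := (finite_populated_len n).toFinset)]
  swap
  · intro μ hμ
    by_contra h
    exact hμ (if_neg (by simpa using h))
  have hterm : ∀ μ ∈ (finite_populated_len n).toFinset,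
      (if Populated μ ∧ len μ = n then star2 b a μ / S μ * Ff f (zm μ) y else 0) =
      (∑ k ∈ Finset.range (n + 1), (k.factorial : ℝ)⁻¹ *
        ∑ α ∈ haf.toFinset, ∑ βs ∈ Fintype.piFinset fun _ : Fin k => hbf.toFinset,
          a α / S α * (∏ j, b (βs j) / S (βs j)) * (coeff μ (insertion α βs) * Ff f (zm μ) y)) +
      b μ / S μ * Ff f (zm μ) y := by
    intro μ hμ
    have hμ' : Populated μ ∧ len μ = n := by simpa using hμ
    rw [if_pos hμ', star2_div_S haf hbf hap hbp, hμ'.2, add_mul, add_comm]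
    simp only [Finset.sum_mul, Finset.mul_sum, mul_assoc]
  rw [Finset.sum_congr rfl hterm, Finset.sum_add_distrib, Finset.sum_comm]
  congr 1
  · refine Finset.sum_congr rfl fun k _ => ?_
    symm
    rw [← Finset.mul_sum, Finset.sum_comm]
    congr 1
    refine Finset.sum_congr rfl fun α hα => ?_
    rw [Finset.sum_comm]
    refine Finset.sum_congr rfl fun βs hβs => ?_
    rw [← Finset.mul_sum, sum_coeff_mul_Ff_of_isWeightedHomogeneous f
      (isWeightedHomogeneous_insertion (hA α hα)
        fun j => hB _ (Fintype.mem_piFinset.1 hβs j))]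
  · rw [← congrFun (Bser_of_pos hbf hbp f hn) y]
    obtain ⟨m, rfl⟩ := Nat.exists_eq_add_of_le' hn
    simp only [Bser]
    rw [finsum_eq_sum_of_support_subset (s := (finite_populated_len (m + 1)).toFinset)]
    · exact Finset.sum_congr rfl fun β hβ => if_pos (by simpa using hβ)
    · intro μ hμ
      by_contra h
      exact hμ (if_neg (by simpa using h))
end

section
/- Corolla decomposition of populated multi-indices: for every populated multi-indice β there exist n ∈ ℕ with β(n) ≠ 0 and populated multi-indices β_1, …, β_n such that β = δ_n + β_1 + ⋯ + β_n. -/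
/-- The weight `∑_k (1 - k) β(k)` of a multi-index. -/
def MI.weight (β : MI) : ℤ := β.sum fun k n => (1 - (k : ℤ)) * n

theorem MI.weight_add (β γ : MI) : (β + γ).weight = β.weight + γ.weight := by
  unfold MI.weight
  exact Finsupp.sum_add_index' (by simp) (by intros; push_cast; ring)

theorem MI.weight_single (k m : ℕ) :
    MI.weight (Finsupp.single k m) = (1 - (k : ℤ)) * m := by
  unfold MI.weight
  exact Finsupp.sum_single_index (by simp)

/-- Only occurrences of `0` contribute positively to the weight. -/
theorem MI.weight_nonpos {β : MI} (h : β 0 = 0) : β.weight ≤ 0 := by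
  refine Finset.sum_nonpos fun k hk => ?_
  have hk0 : k ≠ 0 := by
    rintro rfl
    exact Finsupp.mem_support_iff.mp hk h
  exact mul_nonpos_of_nonpos_of_nonneg (by omega) (by positivity)

theorem MI.exists_eq_single_add {β : MI} {k : ℕ} (h : β k ≠ 0) :
    ∃ γ : MI, β = Finsupp.single k 1 + γ := by
  refine ⟨β - Finsupp.single k 1, (add_tsub_cancel_of_le ?_).symm⟩
  exact Finsupp.single_le_iff.mpr (Nat.one_le_iff_ne_zero.mpr h)

/-- A multi-index of weight `w ≥ 1` is a sum of `w` populated ones. -/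
theorem MI.exists_populated_sum (w : ℕ) (γ : MI) (h : γ.weight = w + 1) :
    ∃ βs : Fin (w + 1) → MI, (∀ i, Populated (βs i)) ∧ γ = ∑ i, βs i := by
  induction w generalizing γ with
  | zero => exact ⟨fun _ => γ, fun _ => by simpa [Populated, MI.weight] using h, by simp⟩
  | succ w ih =>
    have h0 : γ 0 ≠ 0 := fun h0 => by
      have := MI.weight_nonpos h0
      push_cast at h
      omega
    obtain ⟨γ', rfl⟩ := MI.exists_eq_single_add h0
    rw [MI.weight_add, MI.weight_single] at h
    obtain ⟨βs, hp, rfl⟩ := ih γ' (by push_cast at h; omega)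
    refine ⟨Fin.cons (Finsupp.single 0 1) βs, Fin.cases ?_ hp, by simp [Fin.sum_univ_succ]⟩
    exact (MI.weight_single 0 1).trans (by simp)

/-- Corolla decomposition of populated multi-indices: every populated `β` can be written
as `δ_n + β_1 + ⋯ + β_n` with `β(n) ≠ 0` and each `β_i` populated. -/
theorem corolla_decomposition (β : MI) (hβ : Populated β) :
    ∃ (n : ℕ) (βs : Fin n → MI), β n ≠ 0 ∧ (∀ i, Populated (βs i)) ∧
      β = Finsupp.single n 1 + ∑ i, βs i := by
  change β.weight = 1 at hβ
  by_cases h : ∃ m, β (m + 1) ≠ 0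
  · obtain ⟨m, hm⟩ := h
    obtain ⟨γ, rfl⟩ := MI.exists_eq_single_add hm
    rw [MI.weight_add, MI.weight_single] at hβ
    obtain ⟨βs, hp, hsum⟩ := MI.exists_populated_sum m γ (by push_cast at hβ; linarith)
    exact ⟨m + 1, βs, hm, hp, by rw [← hsum]⟩
  · push Not at h
    have hs : β = Finsupp.single 0 (β 0) := by
      ext k
      cases k <;> simp [h]
    rw [hs, MI.weight_single] at hβ
    have h0 : β 0 = 1 := by
      push_cast at hβ
      omega
    exact ⟨0, Fin.elim0, by omega, fun i => i.elim0, by simpa [h0] using hs⟩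
end

section
/- The span of populated multi-indices is the free Novikov algebra on one generator. Let V := span_ℝ { z^β : β populated } ⊆ ℝ[X_0, X_1, …]. A Novikov algebra is an ℝ-vector space N with a bilinear product ⋄ satisfying the left pre-Lie identity (x ⋄ y) ⋄ z − x ⋄ (y ⋄ z) = (y ⋄ x) ⋄ z − y ⋄ (x ⋄ z) and right-commutativity (x ⋄ y) ⋄ z = (x ⋄ z) ⋄ y for all x, y, z. Then: V is closed under the product u ▷ v := u · D(v); (V, ▷) is a Novikov algebra; and for every Novikov algebra (N, ⋄) and every x ∈ N there exists a unique ℝ-linear map φ : V → N with φ(X_0) = x and φ(u ▷ v) = φ(u) ⋄ φ(v) for all u, v ∈ V (note z^{δ_0} = X_0). -/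
open MvPolynomial

/-- The span of the monomials `z^β` with `β` populated. -/
noncomputable def V : Submodule ℝ (MvPolynomial ℕ ℝ) :=
  Submodule.span ℝ {p : MvPolynomial ℕ ℝ | ∃ β : MI, Populated β ∧ p = zm β}

section Operators

variable {N : Type*} [AddCommGroup N] [Module ℝ N] (mul : N →ₗ[ℝ] N →ₗ[ℝ] N)

/-- The algebra of operators generated by the right multiplications of a bilinear product. -/
def rightMulAlg : Subalgebra ℝ (Module.End ℝ N) :=
  Algebra.adjoin ℝ (Set.range mul.flip)

variable {mul}

lemma flip_mem_rightMulAlg (z : N) : mul.flip z ∈ rightMulAlg mul :=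
  Algebra.subset_adjoin ⟨z, rfl⟩

lemma isMulCommutative_rightMulAlg (hcomm : ∀ x y z : N, mul (mul x y) z = mul (mul x z) y) :
    IsMulCommutative (rightMulAlg mul) := by
  refine Algebra.isMulCommutative_adjoin ℝ ?_
  rintro _ ⟨y, rfl⟩ _ ⟨z, rfl⟩
  ext w
  exact hcomm w z y

lemma mul_comm_of_mem_rightMulAlg (hcomm : ∀ x y z : N, mul (mul x y) z = mul (mul x z) y)
    {a b : Module.End ℝ N} (ha : a ∈ rightMulAlg mul) (hb : b ∈ rightMulAlg mul) :
    a * b = b * a := by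
  have := isMulCommutative_rightMulAlg hcomm
  exact setLike_mul_comm ha hb

lemma mul_apply_of_mem_rightMulAlg (hcomm : ∀ x y z : N, mul (mul x y) z = mul (mul x z) y)
    {a : Module.End ℝ N} (ha : a ∈ rightMulAlg mul) (y : N) :
    mul (a y) = a * mul y := by
  induction ha using Algebra.adjoin_induction generalizing y with
  | mem a ha =>
    obtain ⟨z, rfl⟩ := ha
    ext w
    exact hcomm y z w
  | algebraMap r => ext w; simp [Module.algebraMap_end_apply]
  | add a b _ _ iha ihb => rw [LinearMap.add_apply, map_add, iha, ihb, add_mul]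
  | mul a b _ _ iha ihb => rw [Module.End.mul_apply, iha, ihb, mul_assoc]

/-- Commutation with a left multiplication measures the failure of right multiplication
to be linear over `rightMulAlg`. -/
lemma flip_apply_of_mem_rightMulAlg
    (hpl : ∀ x y z : N,
      mul (mul x y) z - mul x (mul y z) = mul (mul y x) z - mul y (mul x z))
    (hcomm : ∀ x y z : N, mul (mul x y) z = mul (mul x z) y)
    {a : Module.End ℝ N} (ha : a ∈ rightMulAlg mul) (y : N) :
    mul.flip (a y) = a * mul.flip y + mul y * a - a * mul y := by
  induction ha using Algebra.adjoin_induction generalizing y with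
  | mem a ha =>
    obtain ⟨z, rfl⟩ := ha
    ext w
    have := hpl w y z
    simp only [LinearMap.flip_apply, LinearMap.add_apply, LinearMap.sub_apply,
      Module.End.mul_apply]
    rw [sub_eq_iff_eq_add] at this
    rw [this]
    abel
  | algebraMap r => ext w; simp [Module.algebraMap_end_apply]
  | add a b _ _ iha ihb =>
    rw [LinearMap.add_apply, map_add, iha, ihb]
    noncomm_ring
  | mul a b ha hb iha ihb =>
    have hab := mul_comm_of_mem_rightMulAlg hcomm ha hb
    have hc : a * (mul y * b - b * mul y) = (mul y * b - b * mul y) * a := by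
      have h : mul y * b - b * mul y = mul.flip (b y) - b * mul.flip y := by
        rw [ihb]; abel
      rw [h]
      exact mul_comm_of_mem_rightMulAlg hcomm ha (sub_mem (flip_mem_rightMulAlg _)
        (mul_mem hb (flip_mem_rightMulAlg _)))
    rw [Module.End.mul_apply, iha, ihb, mul_apply_of_mem_rightMulAlg hcomm hb]
    linear_combination (norm := noncomm_ring) hc - mul y * hab

end Operators

/-- The derivation with the same values as `Dop`. -/
noncomputable def shiftDeriv : Derivation ℝ (MvPolynomial ℕ ℝ) (MvPolynomial ℕ ℝ) :=
  mkDerivation ℝ fun k => X (k + 1)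

lemma Dop_eq_shiftDeriv (p : MvPolynomial ℕ ℝ) : Dop p = shiftDeriv p := by
  have hsupp : (Function.support fun k : ℕ => X (k + 1) * pderiv k p) ⊆ p.vars := by
    intro k hk
    by_contra h
    exact hk (by simp [pderiv_eq_zero_of_notMem_vars (by simpa using h)])
  let S : Derivation ℝ (MvPolynomial ℕ ℝ) (MvPolynomial ℕ ℝ) :=
    ∑ k ∈ p.vars, (X (k + 1) : MvPolynomial ℕ ℝ) • pderiv k
  have hS : ∀ q, S q = ∑ k ∈ p.vars, X (k + 1) * pderiv k q := fun q => by
    have h := congrFun (map_sum (Derivation.coeFnAddMonoidHom (R := ℝ) (A := MvPolynomial ℕ ℝ)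
      (M := MvPolynomial ℕ ℝ)) (fun k => (X (k + 1) : MvPolynomial ℕ ℝ) • pderiv k) p.vars) q
    rwa [Finset.sum_apply] at h
  rw [Dop, finsum_eq_sum_of_support_subset _ hsupp, ← hS]
  refine derivation_eq_of_forall_mem_vars fun i hi => ?_
  rw [hS, shiftDeriv, mkDerivation_X, Finset.sum_eq_single i]
  · simp
  · intro k _ hk
    rw [pderiv_X_of_ne hk.symm, mul_zero]
  · exact fun h => absurd hi h

/-- The embedding `X_k ↦ X_0 ^ k * X_{k+1}` onto the polynomials of weight zero. -/
noncomputable def weightZeroEmb : MvPolynomial ℕ ℝ →ₐ[ℝ] MvPolynomial ℕ ℝ :=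
  aeval fun k => X 0 ^ k * X (k + 1)

/-- The left inverse of `weightZeroEmb` given by `X_0 ↦ 1` and `X_{k+1} ↦ X_k`. -/
noncomputable def dehomogenize : MvPolynomial ℕ ℝ →ₐ[ℝ] MvPolynomial ℕ ℝ :=
  aeval fun k => Nat.casesOn k 1 X

@[simp] lemma weightZeroEmb_X (k : ℕ) : weightZeroEmb (X k) = X 0 ^ k * X (k + 1) := by
  simp [weightZeroEmb]

@[simp] lemma dehomogenize_X_zero : dehomogenize (X 0) = 1 := by simp [dehomogenize]

@[simp] lemma dehomogenize_X_succ (k : ℕ) : dehomogenize (X (k + 1)) = X k := by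
  simp [dehomogenize]

@[simp] lemma dehomogenize_weightZeroEmb (p : MvPolynomial ℕ ℝ) :
    dehomogenize (weightZeroEmb p) = p := by
  have : dehomogenize.comp weightZeroEmb = AlgHom.id ℝ _ := by
    ext k
    simp
  exact DFunLike.congr_fun this p

/-- The derivation induced on `MvPolynomial ℕ ℝ` by `X 0 • D` through `weightZeroEmb`. -/
noncomputable def weightZeroDeriv : Derivation ℝ (MvPolynomial ℕ ℝ) (MvPolynomial ℕ ℝ) :=
  mkDerivation ℝ fun k => (k : MvPolynomial ℕ ℝ) * (X 0 * X k) + X (k + 1)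

lemma weightZeroEmb_weightZeroDeriv (p : MvPolynomial ℕ ℝ) :
    weightZeroEmb (weightZeroDeriv p) = X 0 * shiftDeriv (weightZeroEmb p) := by
  induction p using MvPolynomial.induction_on with
  | C c => simp [← algebraMap_eq]
  | add p q hp hq => simp only [map_add, hp, hq, mul_add]
  | mul_X p k hp =>
    have hX : weightZeroEmb (weightZeroDeriv (X k))
        = X 0 * shiftDeriv (weightZeroEmb (X k)) := by
      cases k <;> simp [weightZeroDeriv, shiftDeriv]; ring
    rw [Derivation.leibniz, map_mul, Derivation.leibniz]
    simp only [smul_eq_mul, map_add, map_mul, hp, hX]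
    ring

/-- The derivation `D` in the coordinates `p ↦ X 0 * weightZeroEmb p` on `V`. -/
lemma shiftDeriv_X_zero_mul_weightZeroEmb (p : MvPolynomial ℕ ℝ) :
    shiftDeriv (X 0 * weightZeroEmb p) = weightZeroEmb (X 0 * p + weightZeroDeriv p) := by
  rw [Derivation.leibniz, map_add, weightZeroEmb_weightZeroDeriv]
  simp [shiftDeriv]
  ring

lemma isWeightedHomogeneous_weightZeroEmb (p : MvPolynomial ℕ ℝ) :
    IsWeightedHomogeneous (fun k : ℕ => 1 - (k : ℤ)) (weightZeroEmb p) 0 := by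
  induction p using MvPolynomial.induction_on with
  | C c => simpa [← algebraMap_eq] using isWeightedHomogeneous_C _ c
  | add p q hp hq => rw [map_add]; exact hp.add hq
  | mul_X p k hp =>
    rw [map_mul, weightZeroEmb_X]
    convert hp.mul (((isWeightedHomogeneous_X ℝ _ 0).pow k).mul
      (isWeightedHomogeneous_X ℝ _ (k + 1))) using 1
    simp

lemma mem_V_of_isWeightedHomogeneous {p : MvPolynomial ℕ ℝ}
    (hp : IsWeightedHomogeneous (fun k : ℕ => 1 - (k : ℤ)) p 1) : p ∈ V := by
  rw [p.as_sum]
  refine sum_mem fun β hβ => ?_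
  have h : monomial β (coeff β p) = coeff β p • zm β := by
    rw [zm, smul_monomial, smul_eq_mul, mul_one]
  rw [h]
  refine V.smul_mem _ (Submodule.subset_span ⟨β, ?_, rfl⟩)
  have := hp (mem_support_iff.1 hβ)
  rw [Finsupp.weight_apply] at this
  simpa [Populated, mul_comm] using this

lemma X_zero_mul_weightZeroEmb_mem_V (p : MvPolynomial ℕ ℝ) : X 0 * weightZeroEmb p ∈ V := by
  refine mem_V_of_isWeightedHomogeneous ?_
  convert (isWeightedHomogeneous_X ℝ _ 0).mul (isWeightedHomogeneous_weightZeroEmb p) using 1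
  simp

lemma exists_X_zero_pow_mul_zm (β : MI) :
    ∃ a b : ℕ, (b : ℤ) - a = (β.sum fun k n => (1 - (k : ℤ)) * n) ∧
      X 0 ^ a * zm β = X 0 ^ b * weightZeroEmb (dehomogenize (zm β)) := by
  induction β using Finsupp.induction_linear with
  | zero => exact ⟨0, 0, by simp [zm, ← C_apply]⟩
  | add β γ hβ hγ =>
    obtain ⟨a, b, hab, h⟩ := hβ
    obtain ⟨c, d, hcd, h'⟩ := hγ
    refine ⟨a + c, b + d, ?_, ?_⟩
    · rw [Finsupp.sum_add_index' (by simp) (by intros; push_cast; ring), ← hab, ← hcd]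
      push_cast
      ring
    · have hz : zm (β + γ) = zm β * zm γ := by simp [zm, monomial_mul]
      rw [hz, map_mul, map_mul]
      linear_combination X 0 ^ c * zm γ * h + X 0 ^ b * weightZeroEmb (dehomogenize (zm β)) * h'
  | single k n =>
    have hz : zm (Finsupp.single k n) = X k ^ n := by simp [zm, X_pow_eq_monomial]
    rw [hz]
    cases k with
    | zero => exact ⟨0, n, by simp⟩
    | succ k => exact ⟨k * n, 0, by simp, by simp [mul_pow, pow_mul]⟩

lemma eq_X_zero_mul_of_mem_V {v : MvPolynomial ℕ ℝ} (hv : v ∈ V) :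
    v = X 0 * weightZeroEmb (dehomogenize v) := by
  induction hv using Submodule.span_induction with
  | mem v hv =>
    obtain ⟨β, hβ, rfl⟩ := hv
    obtain ⟨a, b, hab, h⟩ := exists_X_zero_pow_mul_zm β
    rw [hβ] at hab
    obtain rfl : b = a + 1 := by omega
    refine mul_left_cancel₀ (pow_ne_zero a (X_ne_zero 0)) ?_
    rw [h]
    ring
  | zero => simp
  | add u v _ _ hu hv => rw [map_add, map_add, mul_add, ← hu, ← hv]
  | smul c v _ hv => rw [map_smul, map_smul, mul_smul_comm, ← hv]

lemma dehomogenize_mul_Dop {u v : MvPolynomial ℕ ℝ} (hv : v ∈ V) :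
    dehomogenize (u * Dop v) = dehomogenize u *
      (X 0 * dehomogenize v + weightZeroDeriv (dehomogenize v)) := by
  conv_lhs => rw [eq_X_zero_mul_of_mem_V hv]
  rw [Dop_eq_shiftDeriv, shiftDeriv_X_zero_mul_weightZeroEmb, map_mul,
    dehomogenize_weightZeroEmb]

lemma mul_Dop_mem_V {u v : MvPolynomial ℕ ℝ} (hu : u ∈ V) (hv : v ∈ V) : u * Dop v ∈ V := by
  rw [eq_X_zero_mul_of_mem_V hu, eq_X_zero_mul_of_mem_V hv, Dop_eq_shiftDeriv,
    shiftDeriv_X_zero_mul_weightZeroEmb, mul_assoc, ← map_mul]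
  exact X_zero_mul_weightZeroEmb_mem_V _

section Evaluation

variable {N : Type*} [AddCommGroup N] [Module ℝ N]

/-- The operators by which the generators `X_0 ^ k * X_{k+1}` of weight zero act. -/
def generatorOp (mul : N →ₗ[ℝ] N →ₗ[ℝ] N) (x : N) : ℕ → rightMulAlg mul
  | 0 => ⟨mul.flip x, flip_mem_rightMulAlg x⟩
  | k + 1 => ⟨mul.flip ((generatorOp mul x k : Module.End ℝ N) x), flip_mem_rightMulAlg _⟩
      - (k + 1) • (⟨mul.flip x, flip_mem_rightMulAlg x⟩ * generatorOp mul x k)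

open scoped IsMulCommutative in
lemma exists_evaluation {mul : N →ₗ[ℝ] N →ₗ[ℝ] N}
    (hpl : ∀ x y z : N,
      mul (mul x y) z - mul x (mul y z) = mul (mul y x) z - mul y (mul x z))
    (hcomm : ∀ x y z : N, mul (mul x y) z = mul (mul x z) y) (x : N) :
    ∃ ev : MvPolynomial ℕ ℝ →ₐ[ℝ] Module.End ℝ N,
      ∀ q, mul.flip (ev q x) = ev (X 0 * q + weightZeroDeriv q) := by
  have := isMulCommutative_rightMulAlg hcomm
  let ev : MvPolynomial ℕ ℝ →ₐ[ℝ] Module.End ℝ N :=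
    (rightMulAlg mul).val.comp (aeval (generatorOp mul x))
  have hmem (q) : ev q ∈ rightMulAlg mul := (aeval (generatorOp mul x) q).2
  have hX (k) : ev (X k) = generatorOp mul x k := by simp [ev]
  have hX0 : ev (X 0) = mul.flip x := by rw [hX, generatorOp]
  have hflip (q) := flip_apply_of_mem_rightMulAlg hpl hcomm (hmem q) x
  have hder (q) : ev (weightZeroDeriv q) = mul x * ev q - ev q * mul x := by
    induction q using MvPolynomial.induction_on with
    | C c =>
      rw [← algebraMap_eq, Derivation.map_algebraMap, map_zero, AlgHom.commutes,
        Algebra.commutes, sub_self]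
    | add p q hp hq => rw [map_add, map_add, map_add, hp, hq]; noncomm_ring
    | mul_X p k hp =>
      have hgen : ev (weightZeroDeriv (X k)) = mul x * ev (X k) - ev (X k) * mul x := by
        have h1 : ev (X (k + 1))
            = mul.flip (ev (X k) x) - (k + 1) • (ev (X 0) * ev (X k)) := by
          rw [hX, hX, hX0, generatorOp]
          rfl
        rw [weightZeroDeriv, mkDerivation_X, map_add, h1, hflip, ← hX0,
          ← nsmul_eq_mul, map_nsmul, map_mul,
          mul_comm_of_mem_rightMulAlg hcomm (hmem (X k)) (hmem (X 0)), succ_nsmul]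
        abel
      rw [Derivation.leibniz, map_add, smul_eq_mul, smul_eq_mul,
        mul_comm (X k), map_mul, map_mul, map_mul, hp, hgen]
      noncomm_ring
  refine ⟨ev, fun q => ?_⟩
  rw [hflip, map_add, map_mul, hder, hX0,
    mul_comm_of_mem_rightMulAlg hcomm (hmem q) (flip_mem_rightMulAlg x)]
  abel

end Evaluation

/-- A linear map on `V` which is multiplicative for `u * Dop v` is determined by its value
at `X 0`. -/
lemma novikovHom_eq {N : Type*} [AddCommGroup N] [Module ℝ N] {mul : N →ₗ[ℝ] N →ₗ[ℝ] N}
    {φ ψ : V →ₗ[ℝ] N}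
    (hX : ∀ e : V, (e : MvPolynomial ℕ ℝ) = X 0 → φ e = ψ e)
    (hφ : ∀ u v w : V, (w : MvPolynomial ℕ ℝ) = (u : MvPolynomial ℕ ℝ) * Dop v →
      φ w = mul (φ u) (φ v))
    (hψ : ∀ u v w : V, (w : MvPolynomial ℕ ℝ) = (u : MvPolynomial ℕ ℝ) * Dop v →
      ψ w = mul (ψ u) (ψ v)) : φ = ψ := by
  let m (p : MvPolynomial ℕ ℝ) : V := ⟨X 0 * weightZeroEmb p, X_zero_mul_weightZeroEmb_mem_V p⟩
  have hadd (p q) : m (p + q) = m p + m q := Subtype.ext (by simp [m, mul_add])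
  have hsub (p q) : m (p - q) = m p - m q := Subtype.ext (by simp [m, mul_sub])
  have hsmul (c : ℝ) (p) : m (c • p) = c • m p := Subtype.ext (by simp [m])
  have hstep (p q) (hp : φ (m p) = ψ (m p)) (hq : φ (m q) = ψ (m q)) :
      φ (m (p * (X 0 * q + weightZeroDeriv q))) = ψ (m (p * (X 0 * q + weightZeroDeriv q))) := by
    have h : (m (p * (X 0 * q + weightZeroDeriv q)) : MvPolynomial ℕ ℝ)
        = (m p : MvPolynomial ℕ ℝ) * Dop (m q) := by
      simp only [m]
      rw [Dop_eq_shiftDeriv, shiftDeriv_X_zero_mul_weightZeroEmb, map_mul, mul_assoc]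
    rw [hφ _ _ _ h, hψ _ _ _ h, hp, hq]
  have hone : φ (m 1) = ψ (m 1) := hX _ (by simp [m])
  have hgen (k : ℕ) : ∀ p, φ (m p) = ψ (m p) → φ (m (p * X k)) = ψ (m (p * X k)) := by
    induction k with
    | zero =>
      intro p hp
      simpa using hstep p 1 hp hone
    | succ k ih =>
      intro p hp
      have hk : φ (m (X k)) = ψ (m (X k)) := by simpa using ih 1 hone
      have h : p * X (k + 1) = p * (X 0 * X k + weightZeroDeriv (X k))
          - ((k + 1 : ℕ) : ℝ) • (p * X k * X 0) := by
        rw [weightZeroDeriv, mkDerivation_X, smul_eq_C_mul, map_natCast]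
        push_cast
        ring
      have h0 : φ (m (p * X k * X 0)) = ψ (m (p * X k * X 0)) := by
        simpa using hstep _ 1 (ih p hp) hone
      rw [h, hsub, hsmul, map_sub, map_sub, map_smul, map_smul, h0, hstep p _ hp hk]
  have hall (p) : φ (m p) = ψ (m p) := by
    induction p using MvPolynomial.induction_on with
    | C c =>
      have h : (C c : MvPolynomial ℕ ℝ) = c • 1 := by rw [smul_eq_C_mul, mul_one]
      rw [h, hsmul, map_smul, map_smul, hone]
    | add p q hp hq => rw [hadd, map_add, map_add, hp, hq]
    | mul_X p k hp => exact hgen k p hp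
  ext v
  have hv : v = m (dehomogenize v) := Subtype.ext (eq_X_zero_mul_of_mem_V v.2)
  rw [hv, hall]

/-- The span of populated multi-indices, with `u ▷ v = u · D v`, is the free Novikov
algebra on one generator `X 0 = z^{δ_0}`. -/
theorem free_Novikov_on_populated_multiindices :
    (∀ u v : MvPolynomial ℕ ℝ, u ∈ V → v ∈ V → u * Dop v ∈ V) ∧
    (∀ u v w : MvPolynomial ℕ ℝ, u ∈ V → v ∈ V → w ∈ V →
      ((u * Dop v) * Dop w - u * Dop (v * Dop w)
          = (v * Dop u) * Dop w - v * Dop (u * Dop w)) ∧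
      (u * Dop v) * Dop w = (u * Dop w) * Dop v) ∧
    (∀ (N : Type) [AddCommGroup N] [Module ℝ N] (mul : N →ₗ[ℝ] N →ₗ[ℝ] N),
      (∀ x y z : N, mul (mul x y) z - mul x (mul y z) = mul (mul y x) z - mul y (mul x z)) →
      (∀ x y z : N, mul (mul x y) z = mul (mul x z) y) →
      ∀ x : N, ∃! φ : V →ₗ[ℝ] N,
        (∀ e : V, (e : MvPolynomial ℕ ℝ) = X 0 → φ e = x) ∧
        (∀ u v w : V, (w : MvPolynomial ℕ ℝ) = (u : MvPolynomial ℕ ℝ) * Dop v →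
          φ w = mul (φ u) (φ v))) := by
  refine ⟨fun u v hu hv => mul_Dop_mem_V hu hv, fun u v w _ _ _ => ?_, ?_⟩
  · simp only [Dop_eq_shiftDeriv, Derivation.leibniz, smul_eq_mul]
    constructor <;> ring
  · intro N _ _ mul hpl hcomm x
    obtain ⟨ev, hev⟩ := exists_evaluation hpl hcomm x
    let φ : V →ₗ[ℝ] N :=
      LinearMap.applyₗ x ∘ₗ ev.toLinearMap ∘ₗ dehomogenize.toLinearMap ∘ₗ V.subtype
    have hφ (v : V) : φ v = ev (dehomogenize v) x := rfl
    have hX (e : V) (he : (e : MvPolynomial ℕ ℝ) = X 0) : φ e = x := by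
      simp [hφ, he]
    have hmul (u v w : V) (hw : (w : MvPolynomial ℕ ℝ) = (u : MvPolynomial ℕ ℝ) * Dop v) :
        φ w = mul (φ u) (φ v) := by
      rw [hφ, hw, dehomogenize_mul_Dop v.2, mul_comm, map_mul, ← hev]
      rfl
    refine ⟨φ, ⟨hX, hmul⟩, fun ψ hψ => ?_⟩
    exact novikovHom_eq (fun e he => (hψ.1 e he).trans (hX e he).symm) hψ.2 hmul
end

section
/- Morphism property of the substitution operator M_b with respect to the product ⋆₂: let b be a finitely supported real-valued map on populated multi-indices, let m ≥ 1, and let β̂_1, …, β̂_m and β be populated multi-indices. Then M_b((z^{β̂_1} ⋯ z^{β̂_m}) · D^m(z^β)) = M_b(z^{β̂_1} ⋯ z^{β̂_m}) · D^m(M_b(z^β)). (Here (z^{β̂_1} ⋯ z^{β̂_m}) · D^m(z^β) is the Grossman–Larson-type product ⋆₂ of the forest z^{β̂_1} ⋯ z^{β̂_m} of m populated multi-indices with z^β.) -/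
open MvPolynomial
open scoped Classical

/-- Iterated partial derivatives `∂_{X_{k_1}} ⋯ ∂_{X_{k_n}}`. -/
noncomputable def pderivs : {n : ℕ} → (Fin n → ℕ) → MvPolynomial ℕ ℝ → MvPolynomial ℕ ℝ
  | 0, _, p => p
  | _ + 1, k, p => pderivs (k ∘ Fin.succ) (pderiv (k 0) p)

/-- The simultaneous insertion `(β_1, …, β_n) ⋆₁ p`. -/
noncomputable def insert1 {n : ℕ} (βs : Fin n → MI) (p : MvPolynomial ℕ ℝ) :
    MvPolynomial ℕ ℝ :=
  ∑ᶠ k : Fin n → ℕ, (∏ j, Dop^[k j] (zm (βs j))) * pderivs k p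

/-- The substitution operator
`M_b(p) = ∑_{n ≥ 0} (1/n!) ∑_{(α_1,…,α_n) populated} (∏_j b(α_j)/S(α_j)) (α_1,…,α_n) ⋆₁ p`. -/
noncomputable def Mop (b : MI → ℝ) (p : MvPolynomial ℕ ℝ) : MvPolynomial ℕ ℝ :=
  ∑ᶠ n : ℕ, (n.factorial : ℝ)⁻¹ •
    ∑ᶠ αs : Fin n → MI,
      if ∀ j, Populated (αs j) then (∏ j, b (αs j) / S (αs j)) • insert1 αs p else 0

/-- The derivation `D` as a bundled derivation. -/
noncomputable def shiftDerivation : Derivation ℝ (MvPolynomial ℕ ℝ) (MvPolynomial ℕ ℝ) :=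
  mkDerivation ℝ fun k => X (k + 1)

theorem derivation_sum_apply {ι : Type*} (s : Finset ι)
    (d : ι → Derivation ℝ (MvPolynomial ℕ ℝ) (MvPolynomial ℕ ℝ)) (p : MvPolynomial ℕ ℝ) :
    (∑ i ∈ s, d i) p = ∑ i ∈ s, d i p :=
  (congrFun (map_sum Derivation.coeFnAddMonoidHom d s) p).trans (Finset.sum_apply ..)

theorem Dop_eq_shiftDerivation (p : MvPolynomial ℕ ℝ) : Dop p = shiftDerivation p := by
  have hsupp : (Function.support fun k : ℕ => (X (k + 1) : MvPolynomial ℕ ℝ) * pderiv k p)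
      ⊆ (p.vars : Set ℕ) := by
    intro k hk
    by_contra h
    exact hk (by simp [pderiv_eq_zero_of_notMem_vars (by simpa using h)])
  have hsum : (∑ k ∈ p.vars, (X (k + 1) : MvPolynomial ℕ ℝ) • pderiv k) p
      = shiftDerivation p := by
    refine derivation_eq_of_forall_mem_vars fun i hi => ?_
    simp [shiftDerivation, mkDerivation_X, derivation_sum_apply, pderiv_X, Pi.single_apply, hi]
  rw [Dop, finsum_eq_sum_of_support_subset _ hsupp, ← hsum]
  simp [derivation_sum_apply]

theorem Dop_iterate (k : ℕ) (p : MvPolynomial ℕ ℝ) :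
    Dop^[k] p = ((shiftDerivation : MvPolynomial ℕ ℝ →ₗ[ℝ] MvPolynomial ℕ ℝ) ^ k) p := by
  rw [Module.End.pow_apply]
  congr 2
  exact funext Dop_eq_shiftDerivation

/-- The `n`-th order directional derivative along `g`, using only the variables in `V`. -/
noncomputable def dirDeriv (g : ℕ → MvPolynomial ℕ ℝ) (V : Finset ℕ) :
    ℕ → MvPolynomial ℕ ℝ → MvPolynomial ℕ ℝ
  | 0, p => p
  | n + 1, p => ∑ k ∈ V, g k * dirDeriv g V n (pderiv k p)

theorem dirDeriv_add (g : ℕ → MvPolynomial ℕ ℝ) (V : Finset ℕ) (n : ℕ)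
    (p q : MvPolynomial ℕ ℝ) :
    dirDeriv g V n (p + q) = dirDeriv g V n p + dirDeriv g V n q := by
  induction n generalizing p q with
  | zero => rfl
  | succ n ih => simp [dirDeriv, ih, mul_add, Finset.sum_add_distrib]

theorem dirDeriv_zero_right (g : ℕ → MvPolynomial ℕ ℝ) (V : Finset ℕ) (n : ℕ) :
    dirDeriv g V n 0 = 0 := by
  simpa using dirDeriv_add g V n 0 0

theorem dirDeriv_succ_C (g : ℕ → MvPolynomial ℕ ℝ) (V : Finset ℕ) (n : ℕ) (a : ℝ) :
    dirDeriv g V (n + 1) (C a) = 0 := by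
  simp [dirDeriv, dirDeriv_zero_right]

theorem dirDeriv_succ_mul_X (g : ℕ → MvPolynomial ℕ ℝ) (V : Finset ℕ) (n i : ℕ)
    (p : MvPolynomial ℕ ℝ) :
    dirDeriv g V (n + 1) (p * X i) = dirDeriv g V (n + 1) p * X i
      + (n + 1 : ℝ) • (dirDeriv g V n p * if i ∈ V then g i else 0) := by
  have hsingle (n : ℕ) (p : MvPolynomial ℕ ℝ) :
      ∑ k ∈ V, g k * dirDeriv g V n (p * pderiv k (X i))
        = dirDeriv g V n p * if i ∈ V then g i else 0 := by
    rw [Finset.sum_congr rfl fun k _ => show g k * dirDeriv g V n (p * pderiv k (X i))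
      = if k = i then dirDeriv g V n p * g i else 0 from ?_]
    · simp
    · split_ifs with h
      · subst h
        simp [mul_comm]
      · simp [pderiv_X_of_ne (Ne.symm h), dirDeriv_zero_right]
  have hstep (n : ℕ) (p : MvPolynomial ℕ ℝ) : dirDeriv g V (n + 1) (p * X i)
      = ∑ k ∈ V, g k * dirDeriv g V n (pderiv k p * X i)
        + dirDeriv g V n p * if i ∈ V then g i else 0 := by
    rw [← hsingle, ← Finset.sum_add_distrib, dirDeriv]
    refine Finset.sum_congr rfl fun k _ => ?_
    rw [pderiv_mul, dirDeriv_add, mul_add]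
  induction n generalizing p with
  | zero =>
    rw [hstep]
    simp [dirDeriv, Finset.sum_mul, mul_assoc]
  | succ n ih =>
    rw [hstep]
    have hsum : ∑ k ∈ V, g k * dirDeriv g V (n + 1) (pderiv k p * X i)
        = dirDeriv g V (n + 2) p * X i
          + (n + 1 : ℝ) • (dirDeriv g V (n + 1) p * if i ∈ V then g i else 0) := by
      rw [dirDeriv, dirDeriv.eq_def g V (n + 1) p, Finset.sum_mul, Finset.sum_mul,
        Finset.smul_sum, ← Finset.sum_add_distrib]
      refine Finset.sum_congr rfl fun k _ => ?_
      rw [ih, mul_add, mul_smul_comm]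
      simp only [mul_assoc]
    rw [hsum]
    push_cast
    module

/-- Taylor's formula: the exponential of the directional derivative along `g` is the substitution
`X_k ↦ X_k + g_k`. -/
theorem sum_dirDeriv_eq_aeval (g : ℕ → MvPolynomial ℕ ℝ) (V : Finset ℕ) (p : MvPolynomial ℕ ℝ) :
    ∃ N, ∀ M ≥ N, ∑ n ∈ Finset.range M, (n.factorial : ℝ)⁻¹ • dirDeriv g V n p
      = aeval (fun k => X k + if k ∈ V then g k else 0) p := by
  induction p using MvPolynomial.induction_on with
  | C a =>
    refine ⟨1, fun M hM => ?_⟩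
    obtain ⟨M, rfl⟩ := Nat.exists_eq_add_of_le' hM
    simp only [Finset.sum_range_succ', dirDeriv_succ_C]
    simp [dirDeriv, algebraMap_eq]
  | add p q hp hq =>
    obtain ⟨N, hN⟩ := hp
    obtain ⟨N', hN'⟩ := hq
    refine ⟨max N N', fun M hM => ?_⟩
    rw [map_add, ← hN M (le_trans (le_max_left _ _) hM),
      ← hN' M (le_trans (le_max_right _ _) hM), ← Finset.sum_add_distrib]
    simp only [dirDeriv_add, smul_add]
  | mul_X p i hp =>
    obtain ⟨N, hN⟩ := hp
    refine ⟨N + 1, fun M hM => ?_⟩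
    obtain ⟨M, rfl⟩ := Nat.exists_eq_add_of_le' (le_trans (Nat.le_add_left 1 N) hM)
    have hterm (n : ℕ) : ((n + 1).factorial : ℝ)⁻¹ • dirDeriv g V (n + 1) (p * X i)
        = (((n + 1).factorial : ℝ)⁻¹ • dirDeriv g V (n + 1) p) * X i
          + ((n.factorial : ℝ)⁻¹ • dirDeriv g V n p) * if i ∈ V then g i else 0 := by
      rw [dirDeriv_succ_mul_X, smul_add, smul_smul, smul_mul_assoc, smul_mul_assoc]
      congr 2
      rw [Nat.factorial_succ]
      push_cast
      have : (n.factorial : ℝ) ≠ 0 := by positivity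
      field_simp
    rw [map_mul, aeval_X, mul_add, Finset.sum_range_succ', Finset.sum_congr rfl fun n _ => hterm n,
      Finset.sum_add_distrib, ← Finset.sum_mul, ← Finset.sum_mul, hN M (by omega),
      ← hN (M + 1) (by omega), Finset.sum_range_succ' _ M]
    rw [add_mul _ _ (X i), smul_mul_assoc _ _ (X i)]
    simp only [dirDeriv]
    abel

theorem finsum_dirDeriv_eq_aeval (g : ℕ → MvPolynomial ℕ ℝ) (p : MvPolynomial ℕ ℝ) :
    ∑ᶠ n : ℕ, (n.factorial : ℝ)⁻¹ • dirDeriv g p.vars n p = aeval (fun k => X k + g k) p := by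
  obtain ⟨N, hN⟩ := sum_dirDeriv_eq_aeval g p.vars p
  have hsupp : (Function.support fun n : ℕ => (n.factorial : ℝ)⁻¹ • dirDeriv g p.vars n p)
      ⊆ (Finset.range N : Set ℕ) := by
    intro n hn
    by_contra h
    have hle : N ≤ n := by simpa using h
    have hsucc := hN (n + 1) (by omega)
    rw [Finset.sum_range_succ, hN n hle] at hsucc
    exact hn (by simpa using hsucc)
  rw [finsum_eq_sum_of_support_subset _ hsupp, hN N le_rfl, aeval_def, aeval_def]
  refine eval₂Hom_congr' rfl (fun i hi _ => ?_) rfl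
  simp [hi]

theorem pderivs_zero {n : ℕ} (k : Fin n → ℕ) : pderivs k 0 = 0 := by
  induction n with
  | zero => rfl
  | succ n ih => simp [pderivs, ih]

theorem pderiv_comm (i k : ℕ) (p : MvPolynomial ℕ ℝ) :
    pderiv i (pderiv k p) = pderiv k (pderiv i p) := by
  have h : ⁅pderiv (R := ℝ) i, pderiv (R := ℝ) k⁆ = 0 := by
    refine derivation_ext fun l => ?_
    rw [Derivation.commutator_apply]
    simp [pderiv_X, Pi.single_apply, apply_ite]
  have hp := congrArg (fun d => d p) h
  rw [Derivation.commutator_apply] at hp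
  exact sub_eq_zero.mp hp

theorem pderivs_eq_zero {n : ℕ} (k : Fin n → ℕ) {p : MvPolynomial ℕ ℝ}
    (hk : ∃ j, pderiv (k j) p = 0) : pderivs k p = 0 := by
  induction n generalizing p with
  | zero => exact hk.choose.elim0
  | succ n ih =>
    obtain ⟨j, hj⟩ := hk
    rw [pderivs]
    induction j using Fin.cases with
    | zero => rw [hj, pderivs_zero]
    | succ j => exact ih _ ⟨j, by rw [Function.comp_apply, pderiv_comm, hj, map_zero]⟩

theorem insert1_eq_sum {n : ℕ} (βs : Fin n → MI) (p : MvPolynomial ℕ ℝ) :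
    insert1 βs p = ∑ k ∈ Fintype.piFinset fun _ => p.vars,
      (∏ j, Dop^[k j] (zm (βs j))) * pderivs k p := by
  refine finsum_eq_sum_of_support_subset _ fun k hk => ?_
  by_contra h
  refine hk ?_
  simp only [Finset.mem_coe, Fintype.mem_piFinset, not_forall] at h
  obtain ⟨j, hj⟩ := h
  simp [pderivs_eq_zero k ⟨j, pderiv_eq_zero_of_notMem_vars hj⟩]

theorem sum_prod_mul_pderivs_eq_dirDeriv (g : ℕ → MvPolynomial ℕ ℝ) (V : Finset ℕ) (n : ℕ)
    (p : MvPolynomial ℕ ℝ) :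
    ∑ k ∈ Fintype.piFinset fun _ : Fin n => V, (∏ j, g (k j)) * pderivs k p
      = dirDeriv g V n p := by
  induction n generalizing p with
  | zero => simp [pderivs, dirDeriv]
  | succ n ih =>
    simp only [dirDeriv, ← ih, Finset.mul_sum]
    rw [← Finset.sum_product']
    refine Finset.sum_bij' (fun k _ => (k 0, Fin.tail k)) (fun q _ => Fin.cons q.1 q.2)
      ?_ ?_ ?_ ?_ ?_
    · intro k hk
      simp only [Fintype.mem_piFinset, Finset.mem_product, Fin.tail] at hk ⊢
      exact ⟨hk 0, fun j => hk j.succ⟩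
    · rintro ⟨a, k⟩ hk
      simp only [Fintype.mem_piFinset, Finset.mem_product] at hk ⊢
      exact Fin.cases hk.1 hk.2
    · intro k _
      exact Fin.cons_self_tail k
    · rintro ⟨a, k⟩ _
      simp
    · intro k _
      rw [Fin.prod_univ_succ, pderivs, mul_assoc]
      rfl

/-- The generating polynomial `∑_α b(α)/S(α) z^α`. -/
noncomputable def genPoly (b : MI → ℝ) (hbf : (Function.support b).Finite) : MvPolynomial ℕ ℝ :=
  ∑ α ∈ hbf.toFinset, (b α / S α) • zm α

theorem Mop_eq_aeval (b : MI → ℝ) (hbf : (Function.support b).Finite)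
    (hbp : ∀ β, ¬ Populated β → b β = 0) (p : MvPolynomial ℕ ℝ) :
    Mop b p = aeval (fun k => X k + Dop^[k] (genPoly b hbf)) p := by
  rw [← finsum_dirDeriv_eq_aeval, Mop]
  refine finsum_congr fun n => ?_
  congr 1
  have hif (αs : Fin n → MI) :
      (if ∀ j, Populated (αs j) then (∏ j, b (αs j) / S (αs j)) • insert1 αs p else 0)
        = (∏ j, b (αs j) / S (αs j)) • insert1 αs p := by
    split_ifs with h
    · rfl
    · push Not at h
      obtain ⟨j, hj⟩ := h
      rw [Finset.prod_eq_zero (Finset.mem_univ j) (by simp [hbp _ hj]), zero_smul]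
  have hsupp : (Function.support fun αs : Fin n → MI =>
      (∏ j, b (αs j) / S (αs j)) • insert1 αs p)
        ⊆ (Fintype.piFinset fun _ : Fin n => hbf.toFinset : Finset (Fin n → MI)) := by
    intro αs hαs
    simp only [Finset.mem_coe, Fintype.mem_piFinset, Set.Finite.mem_toFinset]
    intro j hj
    exact hαs (by
      simp only
      rw [Finset.prod_eq_zero (Finset.mem_univ j) (by simp [hj]), zero_smul])
  rw [finsum_congr hif, finsum_eq_sum_of_support_subset _ hsupp,
    ← sum_prod_mul_pderivs_eq_dirDeriv]
  simp only [insert1_eq_sum, Finset.smul_sum]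
  rw [Finset.sum_comm]
  refine Finset.sum_congr rfl fun k _ => ?_
  simp only [Dop_iterate, genPoly, map_sum, map_smul, Finset.prod_univ_sum, Finset.sum_mul]
  refine Finset.sum_congr rfl fun αs _ => ?_
  rw [Finset.prod_smul, smul_mul_assoc]

theorem Dop_aeval (G p : MvPolynomial ℕ ℝ) :
    Dop (aeval (fun k => X k + Dop^[k] G) p) = aeval (fun k => X k + Dop^[k] G) (Dop p) := by
  induction p using MvPolynomial.induction_on with
  | C a => simp [Dop_eq_shiftDerivation, algebraMap_eq, shiftDerivation]
  | add p q hp hq =>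
    simp only [Dop_eq_shiftDerivation, map_add] at hp hq ⊢
    rw [hp, hq]
  | mul_X p i hp =>
    have hX : Dop (X i + Dop^[i] G) = X (i + 1) + Dop^[i + 1] G := by
      rw [Function.iterate_succ_apply', Dop_eq_shiftDerivation, Dop_eq_shiftDerivation, map_add,
        shiftDerivation, mkDerivation_X]
    have hXi : shiftDerivation (X i) = X (i + 1) := mkDerivation_X _ _ _
    rw [Dop_eq_shiftDerivation] at hp hX ⊢
    rw [Dop_eq_shiftDerivation] at hp ⊢
    simp only [map_mul, aeval_X, Derivation.leibniz, hXi, hp, hX, smul_eq_mul, map_add]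

theorem Dop_iterate_aeval (G p : MvPolynomial ℕ ℝ) (m : ℕ) :
    Dop^[m] (aeval (fun k => X k + Dop^[k] G) p)
      = aeval (fun k => X k + Dop^[k] G) (Dop^[m] p) := by
  induction m with
  | zero => rfl
  | succ m ih =>
    rw [Function.iterate_succ_apply', Function.iterate_succ_apply', ih, Dop_aeval]

/-- Morphism property of the substitution operator `M_b` with respect to `⋆₂`. -/
theorem Mop_morphism_star2
    (b : MI → ℝ) (hbf : (Function.support b).Finite)
    (hbp : ∀ β, ¬ Populated β → b β = 0)
    (m : ℕ) (hm : 1 ≤ m) (βh : Fin m → MI) (hβh : ∀ j, Populated (βh j))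
    (β : MI) (hβ : Populated β) :
    Mop b ((∏ j, zm (βh j)) * Dop^[m] (zm β))
      = Mop b (∏ j, zm (βh j)) * Dop^[m] (Mop b (zm β)) := by
  simp only [Mop_eq_aeval b hbf hbp, map_mul, Dop_iterate_aeval]
end

section
/- The composition map of an aromatic tree is a populated multi-indice: let V be a nonempty finite type and out : V → Option V a function (each node has at most one outgoing edge), and assume that the number of v ∈ V with out(v) ≠ none equals (card V) − 1 (so the graph has n nodes and n − 1 arrows). For j ∈ ℕ let κ(j) be the number of v ∈ V whose in-degree card{w ∈ V : out(w) = some v} equals j. Then κ is finitely supported and ∑_j (1 − j)·κ(j) = 1, i.e. κ is a populated multi-indice. -/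
theorem finite_support_card_fiber {V ι : Type*} [Finite V] (d : V → ι) :
    (Function.support fun j => Nat.card {v : V // d v = j}).Finite := by
  refine (Set.finite_range d).subset fun j hj => ?_
  obtain ⟨⟨v, hv⟩⟩ := (Nat.card_ne_zero.mp hj).1
  exact ⟨v, hv⟩

theorem finsum_mul_card_fiber {V ι R : Type*} [Fintype V] [CommSemiring R]
    (d : V → ι) (g : ι → R) :
    ∑ᶠ j, g j * (Nat.card {v : V // d v = j} : R) = ∑ v, g (d v) := by
  classical
  have hsupp : (Function.support fun j => g j * (Nat.card {v : V // d v = j} : R)) ⊆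
      (Finset.univ.image d : Finset ι) := by
    intro j hj
    have hcard : Nat.card {v : V // d v = j} ≠ 0 := by
      intro h
      exact hj (by simp only [h, Nat.cast_zero, mul_zero])
    obtain ⟨⟨v, hv⟩⟩ := (Nat.card_ne_zero.mp hcard).1
    simpa using ⟨v, hv⟩
  rw [finsum_eq_sum_of_support_subset _ hsupp, Finset.sum_comp g d]
  refine Finset.sum_congr rfl fun j _ => ?_
  rw [Nat.card_eq_fintype_card, Fintype.card_subtype, nsmul_eq_mul, mul_comm]

/-- Each arrow of a partial self-map is counted once, by the in-degree of its target. -/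
theorem sum_card_preimage_some {V W : Type*} [Finite V] [Fintype W] (out : V → Option W) :
    ∑ w, Nat.card {v : V // out v = some w} = Nat.card {v : V // out v ≠ none} := by
  rw [← Nat.card_sigma]
  refine Nat.card_congr (Equiv.ofBijective
    (fun p : Σ w, {v : V // out v = some w} => ⟨p.2.1, by simp [p.2.2]⟩) ⟨?_, ?_⟩)
  · rintro ⟨w, v, hv⟩ ⟨w', v', hv'⟩ h
    obtain rfl : v = v' := congrArg Subtype.val h
    obtain rfl : w = w' := Option.some_injective _ (hv.symm.trans hv')
    rfl
  · rintro ⟨v, hv⟩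
    obtain ⟨w, hw⟩ := Option.ne_none_iff_exists'.mp hv
    exact ⟨⟨w, v, hw⟩, rfl⟩


/-- The composition map of an aromatic tree is a populated multi-indice: if a finite
directed graph on a nonempty vertex set `V` with at most one outgoing edge per node
(`out : V → Option V`) has `card V − 1` arrows, then the map
`κ : j ↦ #{v : in-degree of v = j}` is finitely supported and `∑_j (1 − j) κ(j) = 1`. -/
theorem composition_map_of_aromatic_tree_is_populated
    (V : Type) [Fintype V] [Nonempty V] (out : V → Option V)
    (harrows : Nat.card {v : V // out v ≠ none} = Nat.card V - 1) :
    (Function.support fun j : ℕ =>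
        Nat.card {v : V // Nat.card {w : V // out w = some v} = j}).Finite ∧
    ∑ᶠ j : ℕ, (1 - (j : ℤ)) *
        (Nat.card {v : V // Nat.card {w : V // out w = some v} = j} : ℤ) = 1 := by
  refine ⟨finite_support_card_fiber _, ?_⟩
  rw [finsum_mul_card_fiber (fun v => Nat.card {w : V // out w = some v})
    (fun j : ℕ => 1 - (j : ℤ)), Finset.sum_sub_distrib, ← Nat.cast_sum,
    sum_card_preimage_some, harrows, Nat.cast_sub Nat.card_pos]
  simp
end
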